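/- Fix n, m ∈ ℕ and identify Fin(nm) with Fin n × Fin m, and set F_qc^s(n,m) := { p ∈ C_qc^s(nm,2) : π(p) ∈ C_ns^s(n,m) } where π(p)(i,j|x,y) := p(0,0|(x,i),(y,j)). Then F_qc^s(n,m) is a face of C_qc^s(nm,2): if p ∈ F_qc^s(n,m), q, s ∈ C_qc^s(nm,2), λ, μ ≥ 0 with λ + μ = 1 and p = λq + μs with λ, μ > 0, then q, s ∈ F_qc^s(n,m). Moreover F_qc^s(n,m) is a closed subset of ℝ^{(nm)²·4}. -/

import Mathlib

open scoped ComplexOrder BigOperators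

/-- A quantum-commuting representation: a unital C*-algebra with a tracial state τ
and, for each experiment x : X, a projection-valued measure (E x i)_{i : Fin m}. -/
structure QCRep (X : Type) (m : ℕ) where
  A : Type
  [ring : NormedRing A]
  [starRing : StarRing A]
  [cstar : CStarRing A]
  [alg : NormedAlgebra ℂ A]
  [complete : CompleteSpace A]
  [smod : StarModule ℂ A]
  τ : A →ₗ[ℂ] ℂ
  E : X → Fin m → A
  unit : τ 1 = 1
  pos : ∀ a : A, 0 ≤ τ (star a * a)
  tracial : ∀ a b : A, τ (a * b) = τ (b * a)
  proj_sa : ∀ x i, star (E x i) = E x i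
  proj_idem : ∀ x i, E x i * E x i = E x i
  pvm : ∀ x, ∑ i, E x i = 1

attribute [instance] QCRep.ring QCRep.starRing QCRep.cstar QCRep.alg
  QCRep.complete QCRep.smod

/-- Membership in the synchronous quantum-commuting correlation set C_qc^s:
`p x y i j` denotes p(i,j|x,y). -/
def IsQCSyncCorrelation {X : Type} (m : ℕ) (p : X → X → Fin m → Fin m → ℝ) : Prop :=
  ∃ r : QCRep X m, ∀ x y i j, (p x y i j : ℂ) = r.τ (r.E x i * r.E y j)

/-- Membership in the synchronous non-signaling correlation set C_ns^s. -/
def IsSyncNSCorrelation {X : Type} [Fintype X] (m : ℕ)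
    (p : X → X → Fin m → Fin m → ℝ) : Prop :=
  (∀ x y i j, 0 ≤ p x y i j) ∧
  (∀ x y, ∑ i, ∑ j, p x y i j = 1) ∧
  (∀ x i j, i ≠ j → p x x i j = 0) ∧
  (∀ x y y' i, ∑ j, p x y i j = ∑ j, p x y' i j) ∧
  (∀ x x' y j, ∑ i, p x y i j = ∑ i, p x' y i j)


/-- F_qc^s(n,m): elements of C_qc^s(nm,2) (with Fin(nm) identified with Fin n × Fin m)
whose restriction π(p)(i,j|x,y) := p(0,0|(x,i),(y,j)) lies in C_ns^s(n,m). -/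
def IsFqcs (n m : ℕ) (p : (Fin n × Fin m) → (Fin n × Fin m) → Fin 2 → Fin 2 → ℝ) : Prop :=
  IsQCSyncCorrelation 2 p ∧
    IsSyncNSCorrelation m (fun x y i j => p (x, i) (y, j) 0 0)

open Filter Topology in
theorem cs_aux {A : Type} [CStarAlgebra A] (τ : A →ₗ[ℂ] ℂ)
    (pos : ∀ a : A, 0 ≤ τ (star a * a)) :
    (∀ a b : A, ‖τ (star a * b)‖ ^ 2 ≤ (τ (star a * a)).re * (τ (star b * b)).re) ∧
    (∀ a : A, (τ (star a * a)).re ≤ (τ 1).re * ‖a‖ ^ 2) := by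
  let _ := CStarAlgebra.spectralOrder A
  have := CStarAlgebra.spectralOrderedRing A
  have h0 : ∀ x : A, 0 ≤ x → 0 ≤ τ x := by
    intro x hx
    obtain ⟨b, rfl⟩ := CStarAlgebra.nonneg_iff_eq_star_mul_self.mp hx
    exact pos b
  let f : A →ₚ[ℂ] ℂ := PositiveLinearMap.mk₀ τ h0
  have hf : ∀ x, f x = τ x := fun x => rfl
  constructor
  · intro a b
    have h := norm_inner_le_norm (𝕜 := ℂ) (f.toPreGNS a) (f.toPreGNS b)
    rw [PositiveLinearMap.preGNS_inner_def, PositiveLinearMap.preGNS_norm_def,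
      PositiveLinearMap.preGNS_norm_def] at h
    simp only [PositiveLinearMap.ofPreGNS_toPreGNS, hf] at h
    have ha := (Complex.le_def.mp (pos a)).1
    have hb := (Complex.le_def.mp (pos b)).1
    simp only [Complex.zero_re] at ha hb
    calc _ ≤ (√(τ (star a * a)).re * √(τ (star b * b)).re) ^ 2 := by gcongr
      _ = _ := by rw [mul_pow, Real.sq_sqrt ha, Real.sq_sqrt hb]
  · intro a
    have h := PositiveLinearMap.apply_le_of_isSelfAdjoint f (star a * a) (IsSelfAdjoint.star_mul_self a)
    rw [CStarRing.norm_star_mul_self, hf, hf, Algebra.algebraMap_eq_smul_one,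
      ← Complex.coe_smul, map_smul] at h
    have := (Complex.le_def.mp h).1
    simp at this
    nlinarith

theorem QCRep.cs {X : Type} {m : ℕ} (r : QCRep X m) (a b : r.A) :
    ‖r.τ (star a * b)‖ ^ 2 ≤ (r.τ (star a * a)).re * (r.τ (star b * b)).re :=
  let _ : CStarAlgebra r.A := {}
  (cs_aux r.τ r.pos).1 a b

theorem QCRep.bound {X : Type} {m : ℕ} (r : QCRep X m) (a : r.A) : ‖r.τ a‖ ≤ ‖a‖ := by
  let _ : CStarAlgebra r.A := {}
  have h1 := (cs_aux r.τ r.pos).2 a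
  have h2 := r.cs 1 a
  simp [r.unit] at h1 h2
  exact le_of_sq_le_sq (h2.trans h1) (norm_nonneg _)

theorem QCRep.nontriv {X : Type} {m : ℕ} (r : QCRep X m) : Nontrivial r.A := by
  refine ⟨0, 1, fun h => ?_⟩
  have := r.unit
  rw [← h, map_zero] at this
  exact zero_ne_one this

theorem QCRep.norm_E {X : Type} {m : ℕ} (r : QCRep X m) (x : X) (i : Fin m) :
    ‖r.E x i‖ ≤ 1 := by
  have h := CStarRing.norm_star_mul_self (x := r.E x i)
  rw [r.proj_sa, r.proj_idem] at h
  nlinarith [norm_nonneg (r.E x i)]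

open Filter Topology ENNReal in
theorem qc_closed {X : Type} {m : ℕ} (p : ℕ → X → X → Fin m → Fin m → ℝ)
    (p' : X → X → Fin m → Fin m → ℝ) (hp : ∀ k, IsQCSyncCorrelation m (p k))
    (h : Tendsto p atTop (𝓝 p')) : IsQCSyncCorrelation m p' := by
  choose r hr using hp
  have : ∀ k, Nontrivial (r k).A := fun k => (r k).nontriv
  have : ∀ k, NormOneClass (r k).A := fun k => inferInstance
  let B : ℕ → Type := fun k => (r k).A
  let U : Ultrafilter ℕ := hyperfilter ℕ
  have hU : (U : Filter ℕ) ≤ atTop := by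
    rw [← Nat.cofinite_eq_atTop]; exact hyperfilter_le_cofinite
  have ex : ∀ a : lp B ∞, ∃ z : ℂ, Tendsto (fun k => (r k).τ (a k)) U (𝓝 z) := by
    intro a
    have hc := isCompact_closedBall (0 : ℂ) ‖a‖
    obtain ⟨z, -, hz⟩ := hc.ultrafilter_le_nhds (U.map (fun k => (r k).τ (a k))) (by
      rw [le_principal_iff]
      refine Filter.mem_map.mpr (Filter.univ_mem' fun k => ?_)
      simpa using ((r k).bound (a k)).trans (lp.norm_apply_le_norm (by simp) a k))
    exact ⟨z, hz⟩
  choose T hT using ex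
  let τ : lp B ∞ →ₗ[ℂ] ℂ :=
    { toFun := T
      map_add' := fun a b => tendsto_nhds_unique (hT (a + b)) (by
        simpa using (hT a).add (hT b))
      map_smul' := fun c a => tendsto_nhds_unique (hT (c • a)) (by
        simpa using (hT a).const_mul c) }
  have hmem : ∀ x i, Memℓp (fun k => ((r k).E x i : B k)) ∞ := fun x i =>
    memℓp_infty ⟨1, by rintro _ ⟨k, rfl⟩; exact (r k).norm_E x i⟩
  let E : X → Fin m → lp B ∞ := fun x i => ⟨fun k => (r k).E x i, hmem x i⟩
  have hE : ∀ x i k, (E x i) k = (r k).E x i := fun _ _ _ => rfl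
  refine ⟨{ A := lp B ∞, τ := τ, E := E, unit := ?_, pos := ?_, tracial := ?_,
            proj_sa := ?_, proj_idem := ?_, pvm := ?_ }, ?_⟩
  · refine tendsto_nhds_unique (hT 1) ?_
    refine tendsto_const_nhds.congr fun k => ?_
    exact (r k).unit.symm
  · intro a
    exact ge_of_tendsto' (hT (star a * a)) fun k => (r k).pos (a k)
  · intro a b
    refine tendsto_nhds_unique (hT (a * b)) ((hT (b * a)).congr fun k => ?_)
    exact (r k).tracial (b k) (a k)
  · intro x i
    ext k
    exact (r k).proj_sa x i
  · intro x i
    ext k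
    exact (r k).proj_idem x i
  · intro x
    ext k
    rw [lp.coeFn_sum, Finset.sum_apply]
    exact (r k).pvm x
  · intro x y i j
    have h1 : Tendsto (fun k => p k x y i j) atTop (𝓝 (p' x y i j)) :=
      tendsto_pi_nhds.1 (tendsto_pi_nhds.1 (tendsto_pi_nhds.1 (tendsto_pi_nhds.1 h x) y) i) j
    have h2 : Tendsto (fun k => ((p k x y i j : ℝ) : ℂ)) U (𝓝 (p' x y i j : ℂ)) :=
      (Complex.continuous_ofReal.tendsto _).comp (h1.mono_left hU)
    refine tendsto_nhds_unique h2 ((hT (E x i * E y j)).congr fun k => ?_)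
    exact (hr k x y i j).symm

theorem qc_nonneg {X : Type} {m : ℕ} {p : X → X → Fin m → Fin m → ℝ}
    (hp : IsQCSyncCorrelation m p) (x y i j) : 0 ≤ p x y i j := by
  obtain ⟨r, hr⟩ := hp
  have h := r.pos (r.E x i * r.E y j)
  rw [star_mul, r.proj_sa, r.proj_sa, mul_assoc, r.tracial, ← mul_assoc (r.E x i),
    r.proj_idem, mul_assoc, r.proj_idem, ← hr] at h
  exact_mod_cast h

theorem ns_of {n m : ℕ} {q : (Fin n × Fin m) → (Fin n × Fin m) → Fin 2 → Fin 2 → ℝ}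
    (hq : IsQCSyncCorrelation 2 q)
    (h0 : ∀ x i j, i ≠ j → q (x, i) (x, j) 0 0 = 0) :
    (∀ x, ∑ i, ∑ j, q (x, i) (x, j) 0 0 ≤ 1) ∧
    ((∀ x, ∑ i, ∑ j, q (x, i) (x, j) 0 0 = 1) → IsFqcs n m q) := by
  have hq' := hq
  obtain ⟨r, hr⟩ := hq
  let P : Fin n → r.A := fun x => ∑ i, r.E (x, i) 0
  have hPs : ∀ x, star (1 - P x) = 1 - P x := by
    intro x; simp [P, star_sum, r.proj_sa]
  have hPP : ∀ x y, r.τ (P x * P y) = ((∑ i, ∑ j, q (x, i) (y, j) 0 0 : ℝ) : ℂ) := by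
    intro x y
    simp only [P, Finset.sum_mul_sum, map_sum, Complex.ofReal_sum, hr]
  have hP : ∀ x, r.τ (P x) = ((∑ i, ∑ j, q (x, i) (x, j) 0 0 : ℝ) : ℂ) := by
    intro x
    have : ∀ i, ∑ j, q (x, i) (x, j) 0 0 = q (x, i) (x, i) 0 0 := fun i =>
      Finset.sum_eq_single i (fun j _ hj => h0 x i j hj.symm) (by simp)
    simp only [this, P, map_sum, Complex.ofReal_sum, hr, r.proj_idem]
  have hQ : ∀ x, r.τ (star (1 - P x) * (1 - P x)) =
      ((1 - ∑ i, ∑ j, q (x, i) (x, j) 0 0 : ℝ) : ℂ) := by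
    intro x
    rw [hPs, sub_mul, mul_sub, mul_sub, one_mul, mul_one, one_mul, map_sub, map_sub, map_sub,
      hPP, hP, r.unit]
    push_cast
    ring
  constructor
  · intro x
    have h := r.pos (1 - P x)
    rw [hQ] at h
    have : (0 : ℝ) ≤ 1 - ∑ i, ∑ j, q (x, i) (x, j) 0 0 := by exact_mod_cast h
    linarith
  · intro h1
    have hz : ∀ x b, r.τ (P x * b) = r.τ b := by
      intro x b
      have h := r.cs (1 - P x) b
      rw [hQ, h1, hPs, sub_mul, one_mul, map_sub] at h
      simp only [sub_self, Complex.ofReal_zero, Complex.zero_re, zero_mul] at h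
      have h3 : ‖r.τ b - r.τ (P x * b)‖ = 0 := by
        nlinarith [norm_nonneg (r.τ b - r.τ (P x * b))]
      exact (sub_eq_zero.mp (norm_eq_zero.mp h3)).symm
    have hl : ∀ x y j, ((∑ i, q (x, i) (y, j) 0 0 : ℝ) : ℂ) = r.τ (r.E (y, j) 0) := by
      intro x y j
      rw [← hz x]
      simp only [P, Finset.sum_mul, map_sum, Complex.ofReal_sum, hr]
    have hrr : ∀ x y i, ((∑ j, q (x, i) (y, j) 0 0 : ℝ) : ℂ) = r.τ (r.E (x, i) 0) := by
      intro x y i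
      rw [← hz y, r.tracial]
      simp only [P, Finset.mul_sum, map_sum, Complex.ofReal_sum, hr]
    refine ⟨hq', fun x y i j => qc_nonneg hq' _ _ _ _, fun x y => ?_, h0, fun x y y' i => ?_,
      fun x x' y j => ?_⟩
    · have := hPP x y
      rw [hz, hP, h1] at this
      exact_mod_cast this.symm
    · have := (hrr x y i).trans (hrr x y' i).symm
      exact_mod_cast this
    · have := (hl x y j).trans (hl x' y j).symm
      exact_mod_cast this

theorem ns_closed {X : Type} [Fintype X] (m : ℕ) :
    IsClosed {p : X → X → Fin m → Fin m → ℝ | IsSyncNSCorrelation m p} := by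
  simp only [IsSyncNSCorrelation, Set.ofPred_and, Set.ofPred_forall]
  refine IsClosed.inter ?_ (IsClosed.inter ?_ (IsClosed.inter ?_ (IsClosed.inter ?_ ?_)))
  · exact isClosed_iInter fun x => isClosed_iInter fun y => isClosed_iInter fun i =>
      isClosed_iInter fun j => isClosed_le (by fun_prop) (by fun_prop)
  · exact isClosed_iInter fun x => isClosed_iInter fun y => isClosed_eq (by fun_prop) (by fun_prop)
  · exact isClosed_iInter fun x => isClosed_iInter fun y => isClosed_iInter fun i =>
      isClosed_iInter fun j => isClosed_eq (by fun_prop) (by fun_prop)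
  · exact isClosed_iInter fun x => isClosed_iInter fun y => isClosed_iInter fun i =>
      isClosed_iInter fun j => isClosed_eq (by fun_prop) (by fun_prop)
  · exact isClosed_iInter fun x => isClosed_iInter fun y => isClosed_iInter fun i =>
      isClosed_iInter fun j => isClosed_eq (by fun_prop) (by fun_prop)

/-- F_qc^s(n,m) is a face of C_qc^s(nm,2), and it is a closed subset of
the ambient euclidean space of correlations. -/
theorem stmt9 (n m : ℕ) :
    (∀ (p q s : (Fin n × Fin m) → (Fin n × Fin m) → Fin 2 → Fin 2 → ℝ) (l u : ℝ),
      IsFqcs n m p → IsQCSyncCorrelation 2 q → IsQCSyncCorrelation 2 s →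
      0 < l → 0 < u → l + u = 1 →
      (∀ x y i j, p x y i j = l * q x y i j + u * s x y i j) →
      IsFqcs n m q ∧ IsFqcs n m s) ∧
    IsClosed {p : (Fin n × Fin m) → (Fin n × Fin m) → Fin 2 → Fin 2 → ℝ |
      IsFqcs n m p} := by
  constructor
  · intro p q s l u hp hq hs hl hu hlu hpqs
    obtain ⟨-, -, hp1, hp0, -, -⟩ := hp
    have hz : ∀ x i j, i ≠ j → q (x, i) (x, j) 0 0 = 0 ∧ s (x, i) (x, j) 0 0 = 0 := by
      intro x i j hij
      have h := hp0 x i j hij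
      simp only [hpqs] at h
      have a := qc_nonneg hq (x, i) (x, j) 0 0
      have b := qc_nonneg hs (x, i) (x, j) 0 0
      have a' := mul_nonneg hl.le a
      have b' := mul_nonneg hu.le b
      exact ⟨(mul_eq_zero.mp (by linarith : l * q (x, i) (x, j) 0 0 = 0)).resolve_left hl.ne',
        (mul_eq_zero.mp (by linarith : u * s (x, i) (x, j) 0 0 = 0)).resolve_left hu.ne'⟩
    have Hq := ns_of hq fun x i j h => (hz x i j h).1
    have Hs := ns_of hs fun x i j h => (hz x i j h).2
    have key : ∀ x, ∑ i, ∑ j, q (x, i) (x, j) 0 0 = 1 ∧ ∑ i, ∑ j, s (x, i) (x, j) 0 0 = 1 := by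
      intro x
      have h := hp1 x x
      simp only [hpqs, Finset.sum_add_distrib, ← Finset.mul_sum] at h
      have a := Hq.1 x
      have b := Hs.1 x
      constructor <;> nlinarith
    exact ⟨Hq.2 fun x => (key x).1, Hs.2 fun x => (key x).2⟩
  · refine IsSeqClosed.isClosed ?_
    intro pk p' hpk hlim
    refine ⟨qc_closed pk p' (fun k => (hpk k).1) hlim, ?_⟩
    have hc : Continuous (fun (p : (Fin n × Fin m) → (Fin n × Fin m) → Fin 2 → Fin 2 → ℝ)
        (x y : Fin n) (i j : Fin m) => p (x, i) (y, j) 0 0) := by fun_prop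
    exact (ns_closed m).mem_of_tendsto ((hc.tendsto p').comp hlim)
      (Filter.Eventually.of_forall fun k => (hpk k).2)
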